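/- arXiv:1609.05580 — 9 statements merged into one kernel-verified Lean document; each statement's English description precedes it below -/
import Mathlib

section
/- Let d ≥ 1 and let w be any finite string over the alphabet Σ_d = {1,…,d}, of length N = |w|. Then w belongs to exactly N + 1 of the sets W_{(n,ξ)}; more precisely, for each k ∈ {0,1,…,N}, writing w as a concatenation w = u·v with |u| = k and |v| = N − k and setting ξ_k = ρ(u) − ρ(v), the number N − ‖ξ_k‖₁ is even and nonnegative, w ∈ W_{(n_k, ξ_k)} with n_k = (N − ‖ξ_k‖₁)/2, and the N + 1 pairs (n_k, ξ_k), k = 0,…,N, are pairwise distinct and are the only pairs (n,ξ) ∈ ℕ × ℤ^d with w ∈ W_{(n,ξ)}. -/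
/-- Membership of a string `w` over the alphabet `Fin d` in the class
`W_{(n,ξ)}` of `n`-th order words offset by `ξ`. -/
def memW (d n : ℕ) (ξ : Fin d → ℤ) (w : List (Fin d)) : Prop :=
  w.length = 2 * n + ∑ j, (ξ j).natAbs ∧
    ∃ u v : List (Fin d), w = u ++ v ∧ ∀ j, (u.count j : ℤ) - (v.count j : ℤ) = ξ j

/-- The letter counts of a string over a finite alphabet add up to its length. -/
lemma List.sum_count_univ {α : Type*} [Fintype α] [DecidableEq α] (l : List α) :
    ∑ j, l.count j = l.length := by
  simpa using Multiset.sum_count_eq_card (s := Finset.univ) (m := (l : Multiset α)) (by simp)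

/-- The `ℓ¹`-distance of the Parikh vectors of `u` and `v` falls short of `|u| + |v|` by twice
the size of the common part. -/
lemma List.length_add_length_eq_two_mul_sum_min {α : Type*} [Fintype α] [DecidableEq α]
    (u v : List α) :
    u.length + v.length = 2 * ∑ j, min (u.count j) (v.count j) +
      ∑ j, ((u.count j : ℤ) - (v.count j : ℤ)).natAbs := by
  rw [← u.sum_count_univ, ← v.sum_count_univ, Finset.mul_sum, ← Finset.sum_add_distrib,
    ← Finset.sum_add_distrib]
  exact Finset.sum_congr rfl fun j _ => by omega

/-- The coordinates of `ρ(u) - ρ(v)` add up to `|u| - |v|`. -/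
lemma List.sum_count_sub_count {α : Type*} [Fintype α] [DecidableEq α] (u v : List α) :
    ∑ j, ((u.count j : ℤ) - (v.count j : ℤ)) = u.length - v.length := by
  rw [Finset.sum_sub_distrib, ← u.sum_count_univ, ← v.sum_count_univ]
  push_cast
  rfl

theorem every_string_in_exactly_length_succ_classes
    (d : ℕ) (hd : 1 ≤ d) (w : List (Fin d))
    (ξk : ℕ → Fin d → ℤ)
    (hξk : ∀ k j, ξk k j = ((w.take k).count j : ℤ) - ((w.drop k).count j : ℤ))
    (nk : ℕ → ℕ)
    (hnk : ∀ k, nk k = (w.length - ∑ j, (ξk k j).natAbs) / 2) :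
    (∀ k ≤ w.length,
        ∑ j, (ξk k j).natAbs ≤ w.length ∧
        2 ∣ (w.length - ∑ j, (ξk k j).natAbs) ∧
        memW d (nk k) (ξk k) w) ∧
    (∀ k ≤ w.length, ∀ k' ≤ w.length, nk k = nk k' → ξk k = ξk k' → k = k') ∧
    (∀ (n : ℕ) (ξ : Fin d → ℤ), memW d n ξ w → ∃ k ≤ w.length, n = nk k ∧ ξ = ξk k) := by
  have hlen (k : ℕ) : w.length =
      2 * ∑ j, min ((w.take k).count j) ((w.drop k).count j) + ∑ j, (ξk k j).natAbs := by
    simp_rw [hξk]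
    rw [← List.length_add_length_eq_two_mul_sum_min, ← List.length_append,
      List.take_append_drop]
  have hsum (k : ℕ) (hk : k ≤ w.length) : ∑ j, ξk k j = 2 * (k : ℤ) - w.length := by
    simp_rw [hξk]
    rw [List.sum_count_sub_count, List.length_take, List.length_drop]
    omega
  refine ⟨fun k _ => ?_, fun k hk k' hk' _ hξ => ?_, ?_⟩
  · have h := hlen k
    refine ⟨by omega, by omega, ?_, w.take k, w.drop k, (List.take_append_drop k w).symm,
      fun j => (hξk k j).symm⟩
    rw [hnk]
    omega
  · have h := hsum k hk
    rw [hξ, hsum k' hk'] at h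
    omega
  · rintro n ξ ⟨hn, u, v, rfl, huv⟩
    have hξ : ξ = ξk u.length := by
      funext j
      rw [hξk, List.take_left, List.drop_left, huv]
    refine ⟨u.length, by simp, ?_, hξ⟩
    rw [hnk, ← hξ]
    omega
end

section
/- Let d ≥ 1, n ∈ ℕ, and ξ ∈ ℤ^d. Then the cardinality w_{(n,ξ)} of the set W_{(n,ξ)} of n-th order words offset by ξ equals Σ_{ν ∈ ℕ^d, ν₁+⋯+ν_d = n} C(|ν+ξ⁺|; ν+ξ⁺) · C(|ν+ξ⁻|; ν+ξ⁻), where for α ∈ ℕ^d, |α| = Σ_j α_j and C(|α|; α) = |α|!/(α₁!⋯α_d!) is the multinomial coefficient. -/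
/-- Decreasing a nonzero value by one decreases the sum by one. -/
theorem sum_update_pred {α : Type*} [Fintype α] [DecidableEq α] (f : α → ℕ) {m : ℕ} {a : α}
    (ha : f a ≠ 0) (hm : ∑ b, f b = m + 1) : ∑ b, Function.update f a (f a - 1) b = m := by
  have h1 := Finset.sum_update_of_mem (Finset.mem_univ a) f (f a - 1)
  have h2 := Finset.add_sum_erase Finset.univ f (Finset.mem_univ a)
  rw [← Finset.erase_eq] at h1
  omega

theorem List.length_eq_sum_count {α : Type*} [Fintype α] [DecidableEq α] (l : List α) :
    l.length = ∑ a, l.count a := by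
  simpa using (Multiset.sum_count_eq_card (s := Finset.univ) (m := (l : Multiset α))
    (by simp)).symm

/-- The Pascal-type recurrence for multinomial coefficients. -/
theorem Nat.multinomial_univ_eq_sum_update {α : Type*} [Fintype α] [DecidableEq α]
    (f : α → ℕ) {m : ℕ} (hm : ∑ a, f a = m + 1) :
    Nat.multinomial Finset.univ f =
      ∑ a with f a ≠ 0, Nat.multinomial Finset.univ (Function.update f a (f a - 1)) := by
  have hpos : 0 < ∏ a, (f a).factorial := Finset.prod_pos fun a _ => Nat.factorial_pos _
  refine Nat.eq_of_mul_eq_mul_left hpos ?_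
  rw [Nat.multinomial_spec, Finset.mul_sum]
  have key : ∀ a ∈ Finset.univ.filter (fun a => f a ≠ 0),
      (∏ b, (f b).factorial) * Nat.multinomial Finset.univ (Function.update f a (f a - 1)) =
        f a * m.factorial := by
    intro a ha
    have ha0 : f a ≠ 0 := (Finset.mem_filter.1 ha).2
    have hsum := sum_update_pred f ha0 hm
    have hprod : ∏ b, (f b).factorial =
        f a * ∏ b, (Function.update f a (f a - 1) b).factorial := by
      rw [← Finset.mul_prod_erase _ _ (Finset.mem_univ a),
        ← Finset.mul_prod_erase Finset.univ (fun b => (Function.update f a (f a - 1) b).factorial)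
          (Finset.mem_univ a), ← mul_assoc]
      congr 1
      · simp [Nat.mul_factorial_pred ha0]
      · refine Finset.prod_congr rfl fun b hb => ?_
        rw [Function.update_of_ne (Finset.ne_of_mem_erase hb)]
    rw [hprod, mul_assoc, Nat.multinomial_spec, hsum]
  rw [Finset.sum_congr rfl key, ← Finset.sum_mul, Finset.sum_filter_ne_zero, hm,
    Nat.factorial_succ]

/-- The lists with prescribed letter counts `f` form a finite set whose cardinality is the
multinomial coefficient of `f`. -/
theorem exists_finset_list_count_eq {α : Type*} [Fintype α] [DecidableEq α] (f : α → ℕ) :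
    ∃ s : Finset (List α), (∀ l, l ∈ s ↔ ∀ a, l.count a = f a) ∧
      s.card = Nat.multinomial Finset.univ f := by
  induction hm : ∑ a, f a generalizing f with
  | zero =>
    have hf : f = 0 := by
      funext a
      simpa using (Finset.sum_eq_zero_iff.1 hm) a (Finset.mem_univ a)
    subst hf
    refine ⟨{[]}, fun l => ?_, by simp [Nat.multinomial]⟩
    simp [List.count_eq_zero, List.eq_nil_iff_forall_not_mem]
  | succ m ih =>
    have step : ∀ a, ∃ s : Finset (List α), f a ≠ 0 →
        (∀ l, l ∈ s ↔ ∀ b, l.count b = Function.update f a (f a - 1) b) ∧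
          s.card = Nat.multinomial Finset.univ (Function.update f a (f a - 1)) := by
      intro a
      by_cases ha : f a = 0
      · exact ⟨∅, fun h => absurd ha h⟩
      · obtain ⟨s, hs⟩ := ih _ (sum_update_pred f ha hm)
        exact ⟨s, fun _ => hs⟩
    choose s hs using step
    refine ⟨(Finset.univ.filter fun a => f a ≠ 0).biUnion fun a => (s a).image (List.cons a),
      fun l => ?_, ?_⟩
    · simp only [Finset.mem_biUnion, Finset.mem_filter, Finset.mem_univ, true_and,
        Finset.mem_image]
      constructor
      · rintro ⟨a, ha, t, ht, rfl⟩ b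
        have h := ((hs a ha).1 t).1 ht b
        rw [List.count_cons, h]
        by_cases hab : a = b
        · subst hab
          simp only [Function.update_self, beq_self_eq_true, if_true]
          omega
        · simp [hab, Ne.symm hab]
      · intro h
        cases l with
        | nil =>
          have : ∑ a, f a = 0 := Finset.sum_eq_zero fun a _ => by simpa using (h a).symm
          omega
        | cons a t =>
          have ha : f a ≠ 0 := by
            rw [← h a]
            simp
          refine ⟨a, ha, t, ((hs a ha).1 t).2 fun b => ?_, rfl⟩
          have hb := h b
          rw [List.count_cons] at hb
          by_cases hab : a = b
          · subst hab
            simp only [beq_self_eq_true, if_true] at hb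
            simp only [Function.update_self]
            omega
          · simpa [hab, Ne.symm hab] using hb
    · rw [Nat.multinomial_univ_eq_sum_update f hm, Finset.card_biUnion]
      · refine Finset.sum_congr rfl fun a ha => ?_
        rw [Finset.card_image_of_injective _ List.cons_injective,
          (hs a (Finset.mem_filter.1 ha).2).2]
      · intro a _ b _ hab
        refine Finset.disjoint_left.2 fun l hla hlb => ?_
        obtain ⟨t, _, rfl⟩ := Finset.mem_image.1 hla
        obtain ⟨t', _, h⟩ := Finset.mem_image.1 hlb
        exact hab (List.cons.inj h).1.symm

/-- A list over `Fin d` belongs to `W_{(n,ξ)}` iff it splits into two factors whose Parikh vectors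
are `ν + ξ⁺` and `ν + ξ⁻` for some `ν` with sum `n`. -/
theorem memW_iff {d n : ℕ} {ξ : Fin d → ℤ} {w : List (Fin d)} :
    memW d n ξ w ↔ ∃ ν : Fin d → ℕ, ∑ j, ν j = n ∧ ∃ u v : List (Fin d),
      (∀ j, u.count j = ν j + (ξ j).toNat) ∧ (∀ j, v.count j = ν j + (-ξ j).toNat) ∧
        u ++ v = w := by
  have habs : ∑ j, (ξ j).natAbs = ∑ j, (ξ j).toNat + ∑ j, (-ξ j).toNat := by
    rw [← Finset.sum_add_distrib]
    exact Finset.sum_congr rfl fun j _ => by omega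
  constructor
  · rintro ⟨hw, u, v, rfl, h⟩
    have hu : ∀ j, u.count j = (u.count j - (ξ j).toNat) + (ξ j).toNat := fun j => by
      have := h j
      omega
    have hv : ∀ j, v.count j = (u.count j - (ξ j).toNat) + (-ξ j).toNat := fun j => by
      have := h j
      omega
    refine ⟨fun j => u.count j - (ξ j).toNat, ?_, u, v, hu, hv, rfl⟩
    rw [List.length_append, List.length_eq_sum_count u, List.length_eq_sum_count v,
      Finset.sum_congr rfl fun j _ => hu j,
      Finset.sum_congr rfl fun j _ => hv j, Finset.sum_add_distrib, Finset.sum_add_distrib] at hw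
    beta_reduce
    omega
  · rintro ⟨ν, hν, u, v, hu, hv, rfl⟩
    refine ⟨?_, u, v, rfl, fun j => ?_⟩
    · rw [List.length_append, List.length_eq_sum_count u, List.length_eq_sum_count v,
        Finset.sum_congr rfl fun j _ => hu j,
        Finset.sum_congr rfl fun j _ => hv j, Finset.sum_add_distrib, Finset.sum_add_distrib]
      omega
    · rw [hu, hv]
      omega

theorem card_offset_words
    (d n : ℕ) (hd : 1 ≤ d) (ξ : Fin d → ℤ) :
    {w : List (Fin d) | memW d n ξ w}.ncard =
      ∑ ν ∈ Finset.Nat.antidiagonalTuple d n,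
        Nat.multinomial Finset.univ (fun j => ν j + (ξ j).toNat) *
          Nat.multinomial Finset.univ (fun j => ν j + (-ξ j).toNat) := by
  choose s hs hcard using exists_finset_list_count_eq (α := Fin d)
  let T : Finset (Σ _ : Fin d → ℕ, List (Fin d) × List (Fin d)) :=
    (Finset.Nat.antidiagonalTuple d n).sigma fun ν =>
      s (fun j => ν j + (ξ j).toNat) ×ˢ s (fun j => ν j + (-ξ j).toNat)
  have hset : {w : List (Fin d) | memW d n ξ w} = ↑(T.image fun p => p.2.1 ++ p.2.2) := by
    ext w
    simp only [Set.mem_ofPred_eq, memW_iff, Finset.coe_image, Set.mem_image, Finset.mem_coe, T,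
      Finset.mem_sigma, Finset.Nat.mem_antidiagonalTuple, Finset.mem_product, hs, Sigma.exists,
      Prod.exists, exists_and_left, and_assoc]
  have hinj : Set.InjOn (fun p : (Σ _ : Fin d → ℕ, List (Fin d) × List (Fin d)) =>
      p.2.1 ++ p.2.2) T := by
    rintro ⟨ν, u, v⟩ hp ⟨ν', u', v'⟩ hp' h
    simp only [T, Finset.mem_coe, Finset.mem_sigma, Finset.Nat.mem_antidiagonalTuple,
      Finset.mem_product, hs] at hp hp'
    obtain ⟨hν, hu, -⟩ := hp
    obtain ⟨hν', hu', -⟩ := hp'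
    have hl : u.length = u'.length := by
      rw [List.length_eq_sum_count u, List.length_eq_sum_count u', Finset.sum_congr rfl fun j _ => hu j,
        Finset.sum_congr rfl fun j _ => hu' j, Finset.sum_add_distrib, Finset.sum_add_distrib,
        hν, hν']
    obtain ⟨rfl, rfl⟩ := List.append_inj h hl
    obtain rfl : ν = ν' := funext fun j => by
      have h1 : u.count j = ν j + (ξ j).toNat := hu j
      have h2 : u.count j = ν' j + (ξ j).toNat := hu' j
      omega
    rfl
  rw [hset, Set.ncard_coe_finset, Finset.card_image_of_injOn hinj, Finset.card_sigma]
  simp only [Finset.card_product, hcard]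
end

section
/- Let d ≥ 1, let x be a real number with |x| < 1/d, and let ξ ∈ ℤ^d. Then the ξ-th Fourier coefficient of the spectral density function of p[x]*_{1,d}, namely (2π)^{−d} ∫_{[0,2π]^d} e^{−i(ξ₁θ₁+⋯+ξ_dθ_d)} · |1 − x(e^{iθ₁}+⋯+e^{iθ_d})|^{−2} dθ, equals the convergent series Σ_{n=0}^∞ w_{(n,ξ)} x^{2n+‖ξ‖₁}; i.e., the ξ-th Fourier coefficient is the ordinary generating function for w_{(n,ξ)} counted according to the length 2n + ‖ξ‖₁. -/
/-- The number `w_{(n,ξ)}` of `n`-th order words offset by `ξ` over a `d`-letter alphabet. -/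
def wcount (d n : ℕ) (ξ : Fin d → ℤ) : ℕ :=
  ∑ ν ∈ Finset.Nat.antidiagonalTuple d n,
    Nat.multinomial Finset.univ (fun j => ν j + (ξ j).toNat) *
      Nat.multinomial Finset.univ (fun j => ν j + (-ξ j).toNat)

/-- Summation over `ℕ^d` grouped by total degree. -/
theorem HasSum.sum_antidiagonalTuple {E : Type*} [NormedAddCommGroup E] {d : ℕ}
    {f : (Fin d → ℕ) → E} {a : E} (hf : HasSum f a) :
    HasSum (fun n => ∑ ν ∈ Finset.Nat.antidiagonalTuple d n, f ν) a := by
  have h := (Equiv.sigmaFiberEquiv fun ν : Fin d → ℕ => ∑ j, ν j).hasSum_iff.mpr hf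
  refine h.sigma fun n => ?_
  have hmem : ∀ ν : Fin d → ℕ, ν ∈ Finset.Nat.antidiagonalTuple d n ↔ ∑ j, ν j = n :=
    fun ν => Finset.Nat.mem_antidiagonalTuple
  let _ := Fintype.subtype _ hmem
  rw [Finset.sum_subtype _ hmem]
  exact hasSum_fintype _

theorem summable_of_summable_sum_antidiagonalTuple {d : ℕ} {f : (Fin d → ℕ) → ℝ}
    (hf : ∀ ν, 0 ≤ f ν)
    (h : Summable fun n => ∑ ν ∈ Finset.Nat.antidiagonalTuple d n, f ν) : Summable f := by
  rw [← (Equiv.sigmaFiberEquiv fun ν : Fin d → ℕ => ∑ j, ν j).summable_iff,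
    summable_sigma_of_nonneg fun _ => by exact hf _]
  have hmem : ∀ n (ν : Fin d → ℕ), ν ∈ Finset.Nat.antidiagonalTuple d n ↔ ∑ j, ν j = n :=
    fun n ν => Finset.Nat.mem_antidiagonalTuple
  let _ := fun n => Fintype.subtype _ (hmem n)
  refine ⟨fun n => (hasSum_fintype _).summable, h.congr fun n => ?_⟩
  rw [Finset.sum_subtype _ (hmem n), tsum_fintype]
  rfl

theorem sum_antidiagonalTuple_multinomial {R : Type*} [CommSemiring R] {d : ℕ}
    (z : Fin d → R) (n : ℕ) :
    ∑ ν ∈ Finset.Nat.antidiagonalTuple d n, (Nat.multinomial Finset.univ ν : R) * ∏ j, z j ^ ν j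
      = (∑ j, z j) ^ n := by
  rw [Finset.sum_pow_eq_sum_piAntidiag]
  congr 1
  ext ν
  simp [Finset.Nat.mem_antidiagonalTuple]

theorem summable_norm_multinomial {d : ℕ} {z : Fin d → ℂ} (hz : ∑ j, ‖z j‖ < 1) :
    Summable fun ν : Fin d → ℕ => ‖(Nat.multinomial Finset.univ ν : ℂ) * ∏ j, z j ^ ν j‖ := by
  have h0 : 0 ≤ ∑ j, ‖z j‖ := Finset.sum_nonneg fun _ _ => norm_nonneg _
  refine summable_of_summable_sum_antidiagonalTuple (fun _ => norm_nonneg _) ?_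
  refine (summable_geometric_of_lt_one h0 hz).congr fun n => ?_
  rw [← sum_antidiagonalTuple_multinomial]
  simp

theorem hasSum_multinomial {d : ℕ} {z : Fin d → ℂ} (hz : ∑ j, ‖z j‖ < 1) :
    HasSum (fun ν : Fin d → ℕ => (Nat.multinomial Finset.univ ν : ℂ) * ∏ j, z j ^ ν j)
      (1 - ∑ j, z j)⁻¹ := by
  have hs := (summable_norm_multinomial hz).of_norm.hasSum
  have h := hs.sum_antidiagonalTuple
  simp only [sum_antidiagonalTuple_multinomial] at h
  have hlt : ‖∑ j, z j‖ < 1 := (norm_sum_le _ _).trans_lt hz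
  rwa [h.unique (hasSum_geometric_of_norm_lt_one hlt)] at hs

theorem setIntegral_exp_int_mul_I (k : ℤ) :
    ∫ t in Set.Icc (0 : ℝ) (2 * Real.pi), Complex.exp (Complex.I * k * (t : ℂ))
      = if k = 0 then (2 * Real.pi : ℂ) else 0 := by
  have hpi : (0 : ℝ) ≤ 2 * Real.pi := by positivity
  rw [MeasureTheory.integral_Icc_eq_integral_Ioc, ← intervalIntegral.integral_of_le hpi]
  split_ifs with hk
  · simp [hk]
  · have hc : Complex.I * (k : ℂ) ≠ 0 := mul_ne_zero Complex.I_ne_zero (by exact_mod_cast hk)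
    rw [integral_exp_mul_complex hc]
    have : Complex.I * (k : ℂ) * ((2 * Real.pi : ℝ) : ℂ) = k * (2 * Real.pi * Complex.I) := by
      push_cast; ring
    rw [this, Complex.exp_int_mul_two_pi_mul_I]
    simp

/-- Orthogonality of the characters of the torus. -/
theorem setIntegral_prod_exp {d : ℕ} (k : Fin d → ℤ) :
    ∫ θ in Set.univ.pi fun _ : Fin d => Set.Icc (0:ℝ) (2 * Real.pi),
        ∏ j, Complex.exp (Complex.I * k j * (θ j : ℂ))
      = if k = 0 then (2 * Real.pi : ℂ) ^ d else 0 := by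
  rw [MeasureTheory.volume_pi, MeasureTheory.Measure.restrict_pi_pi,
    MeasureTheory.integral_fintype_prod_eq_prod
      (fun j (t : ℝ) => Complex.exp (Complex.I * k j * (t : ℂ)))]
  simp only [setIntegral_exp_int_mul_I]
  split_ifs with hk
  · simp [hk]
  · obtain ⟨j, hj⟩ := Function.ne_iff.mp hk
    exact Finset.prod_eq_zero (Finset.mem_univ j) (if_neg hj)

theorem prod_exp_sub_sub {d : ℕ} (α β : Fin d → ℕ) (ξ : Fin d → ℤ) (θ : Fin d → ℝ) :
    ∏ j, Complex.exp (Complex.I * ((α j - β j - ξ j : ℤ) : ℂ) * (θ j : ℂ))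
      = Complex.exp (-Complex.I * ∑ j, (ξ j : ℂ) * (θ j : ℂ)) *
        ((∏ j, Complex.exp (Complex.I * θ j) ^ α j) *
          ∏ j, Complex.exp (-(Complex.I * θ j)) ^ β j) := by
  rw [Finset.mul_sum, Complex.exp_sum, ← Finset.prod_mul_distrib, ← Finset.prod_mul_distrib]
  refine Finset.prod_congr rfl fun j _ => ?_
  rw [← Complex.exp_nat_mul, ← Complex.exp_nat_mul, ← Complex.exp_add, ← Complex.exp_add]
  congr 1
  push_cast
  ring

theorem hasSum_spectralDensity {d : ℕ} {x : ℝ} (hx : d * |x| < 1) (ξ : Fin d → ℤ)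
    (θ : Fin d → ℝ) :
    HasSum (fun p : (Fin d → ℕ) × (Fin d → ℕ) =>
        (((Nat.multinomial Finset.univ p.1 * x ^ ∑ j, p.1 j) *
          (Nat.multinomial Finset.univ p.2 * x ^ ∑ j, p.2 j) : ℝ) : ℂ) *
          ∏ j, Complex.exp (Complex.I * ((p.1 j - p.2 j - ξ j : ℤ) : ℂ) * (θ j : ℂ)))
      (Complex.exp (-Complex.I * ∑ j, (ξ j : ℂ) * (θ j : ℂ)) *
        ((1 / Complex.normSq (1 - (x:ℂ) * ∑ j, Complex.exp (Complex.I * (θ j : ℂ))) : ℝ) : ℂ)) := by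
  obtain ⟨z, hz⟩ : ∃ z : Fin d → ℂ, z = fun j => x * Complex.exp (Complex.I * θ j) := ⟨_, rfl⟩
  obtain ⟨w, hw⟩ : ∃ w : Fin d → ℂ, w = fun j => x * Complex.exp (-(Complex.I * θ j)) := ⟨_, rfl⟩
  have hzn : ∑ j, ‖z j‖ < 1 := by simpa [hz, Complex.norm_exp] using hx
  have hwn : ∑ j, ‖w j‖ < 1 := by simpa [hw, Complex.norm_exp] using hx
  have hs := summable_mul_of_summable_norm (summable_norm_multinomial hzn)
    (summable_norm_multinomial hwn)
  have hmul := ((hasSum_multinomial hzn).mul (hasSum_multinomial hwn) hs).mul_left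
    (Complex.exp (-Complex.I * ∑ j, (ξ j : ℂ) * (θ j : ℂ)))
  refine (congrArg₂ HasSum (funext fun p => ?_) ?_).mpr hmul
  · rw [prod_exp_sub_sub]
    simp only [hz, hw, mul_pow, Finset.prod_mul_distrib, Finset.prod_pow_eq_pow_sum]
    push_cast
    ring
  · congr 1
    have hconj : 1 - ∑ j, w j = (starRingEnd ℂ) (1 - ∑ j, z j) := by
      simp [hz, hw, ← Complex.exp_conj]
    have hsum : (x : ℂ) * ∑ j, Complex.exp (Complex.I * (θ j : ℂ)) = ∑ j, z j := by
      rw [hz, Finset.mul_sum]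
    rw [hsum, hconj, ← mul_inv, Complex.mul_conj]
    push_cast
    rw [one_div]

theorem hasSum_integral_spectralDensity {d : ℕ} {x : ℝ} (hx : d * |x| < 1) (ξ : Fin d → ℤ) :
    HasSum (fun p : (Fin d → ℕ) × (Fin d → ℕ) =>
        (((Nat.multinomial Finset.univ p.1 * x ^ ∑ j, p.1 j) *
          (Nat.multinomial Finset.univ p.2 * x ^ ∑ j, p.2 j) : ℝ) : ℂ) *
          if (fun j => (p.1 j - p.2 j - ξ j : ℤ)) = 0 then (2 * Real.pi : ℂ) ^ d else 0)
      (∫ θ in Set.univ.pi fun _ : Fin d => Set.Icc (0:ℝ) (2 * Real.pi),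
          Complex.exp (-Complex.I * ∑ j, (ξ j : ℂ) * (θ j : ℂ)) *
            ((1 / Complex.normSq (1 - (x:ℂ) * ∑ j, Complex.exp (Complex.I * (θ j : ℂ))) : ℝ) :
              ℂ)) := by
  set box : Set (Fin d → ℝ) := Set.univ.pi fun _ : Fin d => Set.Icc (0:ℝ) (2 * Real.pi)
  have hbox : IsCompact box := isCompact_univ_pi fun _ => isCompact_Icc
  set F : (Fin d → ℕ) × (Fin d → ℕ) → (Fin d → ℝ) → ℂ := fun p θ =>
    (((Nat.multinomial Finset.univ p.1 * x ^ ∑ j, p.1 j) *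
      (Nat.multinomial Finset.univ p.2 * x ^ ∑ j, p.2 j) : ℝ) : ℂ) *
      ∏ j, Complex.exp (Complex.I * ((p.1 j - p.2 j - ξ j : ℤ) : ℂ) * (θ j : ℂ)) with hF
  have hFnorm : ∀ p θ, ‖F p θ‖ = ‖F p 0‖ := by
    intro p θ
    simp [hF, Complex.norm_exp]
  have hint : ∀ p, MeasureTheory.IntegrableOn (F p) box := fun p =>
    ContinuousOn.integrableOn_compact hbox (by fun_prop)
  have hsum : Summable fun p => ∫ θ in box, ‖F p θ‖ := by
    simp only [hFnorm, MeasureTheory.integral_const, smul_eq_mul]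
    exact (hasSum_spectralDensity hx ξ 0).summable.norm.mul_left _
  have h := MeasureTheory.hasSum_integral_of_summable_integral_norm hint hsum
  simp only [hF, MeasureTheory.integral_const_mul, setIntegral_prod_exp,
    (hasSum_spectralDensity hx ξ _).tsum_eq, box] at h
  exact h

theorem hasSum_wcount {d : ℕ} {x : ℝ} (hx : d * |x| < 1) (ξ : Fin d → ℤ) :
    HasSum (fun n : ℕ => (((wcount d n ξ : ℝ) * x ^ (2 * n + ∑ j, (ξ j).natAbs) : ℝ) : ℂ))
      ((1 / (2 * Real.pi) ^ d : ℝ) •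
        ∫ θ in Set.univ.pi fun _ : Fin d => Set.Icc (0:ℝ) (2 * Real.pi),
          Complex.exp (-Complex.I * ∑ j, (ξ j : ℂ) * (θ j : ℂ)) *
            ((1 / Complex.normSq (1 - (x:ℂ) * ∑ j, Complex.exp (Complex.I * (θ j : ℂ))) : ℝ) :
              ℂ)) := by
  set g : (Fin d → ℕ) → (Fin d → ℕ) × (Fin d → ℕ) := fun ν =>
    (fun j => ν j + (ξ j).toNat, fun j => ν j + (-ξ j).toNat) with hg
  have hinj : Function.Injective g := by
    intro ν ν' h
    ext j
    have := congrFun (congrArg Prod.fst h) j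
    simpa [hg] using this
  have h := (hasSum_integral_spectralDensity hx ξ).const_smul (1 / (2 * Real.pi) ^ d : ℝ)
  rw [← hinj.hasSum_iff] at h
  · refine (congrArg (HasSum · _) (funext fun n => ?_)).mpr h.sum_antidiagonalTuple
    rw [wcount]
    push_cast
    rw [Finset.sum_mul]
    refine Finset.sum_congr rfl fun ν hν => ?_
    rw [Finset.Nat.mem_antidiagonalTuple] at hν
    have hdiff : (fun j => (((ν j + (ξ j).toNat : ℕ) : ℤ) - ((ν j + (-ξ j).toNat : ℕ) : ℤ) - ξ j))
        = 0 := by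
      ext j
      simp only [Pi.zero_apply]
      omega
    have hlen : 2 * n + ∑ j, (ξ j).natAbs
        = ∑ j, (ν j + (ξ j).toNat) + ∑ j, (ν j + (-ξ j).toNat) := by
      rw [← hν, Finset.mul_sum, ← Finset.sum_add_distrib, ← Finset.sum_add_distrib]
      exact Finset.sum_congr rfl fun j _ => by omega
    have hpi : (Real.pi : ℂ) ≠ 0 := by exact_mod_cast Real.pi_ne_zero
    simp only [Function.comp_apply, hg, hdiff, if_true, Complex.real_smul, hlen, pow_add]
    push_cast
    field_simp
  · rintro ⟨α, β⟩ hp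
    rw [if_neg, mul_zero, smul_zero]
    intro h0
    refine hp ⟨fun j => α j - (ξ j).toNat, ?_⟩
    have hj : ∀ j, (α j : ℤ) - β j - ξ j = 0 := fun j => congrFun h0 j
    simp only [hg, Prod.mk.injEq]
    constructor <;> ext j <;> have := hj j <;> omega

theorem fourierCoeff_spd_eq_ogf
    (d : ℕ) (hd : 1 ≤ d) (x : ℝ) (hx : |x| < 1 / d) (ξ : Fin d → ℤ) :
    (Summable fun n : ℕ => (wcount d n ξ : ℝ) * x ^ (2 * n + ∑ j, (ξ j).natAbs)) ∧
    (1 / (2 * Real.pi) ^ d : ℝ) •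
        ∫ θ in Set.univ.pi fun _ : Fin d => Set.Icc (0:ℝ) (2 * Real.pi),
          Complex.exp (-Complex.I * ∑ j, (ξ j : ℂ) * (θ j : ℂ)) *
            ((1 / Complex.normSq (1 - (x:ℂ) * ∑ j, Complex.exp (Complex.I * (θ j : ℂ))) : ℝ) : ℂ)
      = ((∑' n : ℕ, (wcount d n ξ : ℝ) * x ^ (2 * n + ∑ j, (ξ j).natAbs) : ℝ) : ℂ) := by
  have hd0 : (0 : ℝ) < d := by exact_mod_cast hd
  have hx' : d * |x| < 1 := by rwa [lt_div_iff₀ hd0, mul_comm] at hx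
  have h := hasSum_wcount hx' ξ
  refine ⟨Complex.summable_ofReal.mp h.summable, ?_⟩
  rw [Complex.ofReal_tsum, h.tsum_eq]
end

section
/- Let d ≥ 1, n ∈ ℕ, and ξ ∈ ℤ^d. Then w_{(n,ξ)} = (2π)^{−d} ∫_{[0,2π]^d} e^{−i(ξ₁θ₁+⋯+ξ_dθ_d)} · (e^{iθ₁}+⋯+e^{iθ_d})^{n+|ξ⁺|} · (e^{−iθ₁}+⋯+e^{−iθ_d})^{n+|ξ⁻|} dθ. -/
open MeasureTheory

/-- Integral of a character of the circle over one period. -/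
lemma integral_Icc_exp_int (k : ℤ) :
    ∫ t in Set.Icc (0:ℝ) (2 * Real.pi), Complex.exp (Complex.I * ((k : ℂ) * (t : ℂ))) =
      if k = 0 then ((2 * Real.pi : ℝ) : ℂ) else 0 := by
  rw [integral_Icc_eq_integral_Ioc, ← intervalIntegral.integral_of_le (by positivity)]
  split_ifs with hk
  · simp [hk]
  · have hc : Complex.I * (k : ℂ) ≠ 0 := by simp [hk]
    simp_rw [← mul_assoc]
    rw [integral_exp_mul_complex hc]
    have h : Complex.exp (Complex.I * k * ((2 * Real.pi : ℝ) : ℂ)) = 1 := by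
      rw [← Complex.exp_int_mul_two_pi_mul_I k]
      congr 1
      push_cast
      ring
    rw [h]
    simp

/-- Orthogonality of characters of the torus, on the box `[0, 2π]^d`. -/
lemma integral_box_exp_int {ι : Type*} [Fintype ι] (k : ι → ℤ) :
    ∫ θ in Set.univ.pi fun _ : ι => Set.Icc (0:ℝ) (2 * Real.pi),
        Complex.exp (Complex.I * ∑ j, (k j : ℂ) * (θ j : ℂ)) =
      if k = 0 then (((2 * Real.pi) ^ Fintype.card ι : ℝ) : ℂ) else 0 := by
  simp_rw [Finset.mul_sum, Complex.exp_sum]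
  rw [volume_pi, Measure.restrict_pi_pi,
    integral_fintype_prod_eq_prod
      (fun j (t : ℝ) => Complex.exp (Complex.I * ((k j : ℂ) * (t : ℂ))))]
  simp_rw [integral_Icc_exp_int]
  split_ifs with hk
  · simp [hk]
  · obtain ⟨j, hj⟩ := Function.ne_iff.mp hk
    exact Finset.prod_eq_zero (Finset.mem_univ j) (if_neg hj)

/-- Expansion of the generating function into characters of the torus. -/
lemma exp_mul_sum_pow_mul_sum_pow {ι : Type*} [Fintype ι] [DecidableEq ι]
    (ξ : ι → ℤ) (M N : ℕ) (θ : ι → ℝ) :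
    Complex.exp (-Complex.I * ∑ j, (ξ j : ℂ) * (θ j : ℂ)) *
        (∑ j, Complex.exp (Complex.I * (θ j : ℂ))) ^ M *
        (∑ j, Complex.exp (-Complex.I * (θ j : ℂ))) ^ N =
      ∑ p ∈ Finset.piAntidiag Finset.univ M ×ˢ Finset.piAntidiag Finset.univ N,
        ((Nat.multinomial Finset.univ p.1 * Nat.multinomial Finset.univ p.2 : ℕ) : ℂ) *
          Complex.exp (Complex.I *
            ∑ j, (((p.1 j : ℤ) - (p.2 j : ℤ) - ξ j : ℤ) : ℂ) * (θ j : ℂ)) := by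
  rw [Finset.sum_pow_eq_sum_piAntidiag, Finset.sum_pow_eq_sum_piAntidiag, mul_assoc,
    Finset.sum_mul_sum, ← Finset.sum_product', Finset.mul_sum]
  refine Finset.sum_congr rfl fun p _ => ?_
  have h : Complex.exp (Complex.I *
      ∑ j, (((p.1 j : ℤ) - (p.2 j : ℤ) - ξ j : ℤ) : ℂ) * (θ j : ℂ)) =
      Complex.exp (-Complex.I * ∑ j, (ξ j : ℂ) * (θ j : ℂ)) *
        (∏ j, Complex.exp (Complex.I * (θ j : ℂ)) ^ p.1 j) *
        ∏ j, Complex.exp (-Complex.I * (θ j : ℂ)) ^ p.2 j := by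
    simp_rw [← Complex.exp_nat_mul, ← Complex.exp_sum, ← Complex.exp_add, Finset.mul_sum,
      ← Finset.sum_add_distrib]
    congr 1
    refine Finset.sum_congr rfl fun j _ => ?_
    push_cast
    ring
  rw [h]
  push_cast
  ring

/-- `wcount` counts pairs of words whose letter counts differ by `ξ`. -/
lemma wcount_eq_sum_filter (d n : ℕ) (ξ : Fin d → ℤ) :
    wcount d n ξ =
      ∑ p ∈ Finset.piAntidiag Finset.univ (n + ∑ j, (ξ j).toNat) ×ˢ
          Finset.piAntidiag Finset.univ (n + ∑ j, (-ξ j).toNat) with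
          (fun j => (p.1 j : ℤ) - (p.2 j : ℤ) - ξ j) = 0,
        Nat.multinomial Finset.univ p.1 * Nat.multinomial Finset.univ p.2 := by
  refine Finset.sum_nbij'
    (fun ν => (fun j => ν j + (ξ j).toNat, fun j => ν j + (-ξ j).toNat))
    (fun p j => p.1 j - (ξ j).toNat) ?_ ?_ ?_ ?_ ?_
  · intro ν hν
    rw [Finset.Nat.mem_antidiagonalTuple] at hν
    simp only [Finset.mem_filter, Finset.mem_product, Finset.mem_piAntidiag,
      Finset.sum_add_distrib, hν, Finset.mem_univ, implies_true, and_self, true_and]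
    funext j
    simp only [Pi.zero_apply]
    omega
  · intro p hp
    simp only [Finset.mem_filter, Finset.mem_product, Finset.mem_piAntidiag,
      Finset.mem_univ, implies_true, and_true] at hp
    rw [Finset.Nat.mem_antidiagonalTuple]
    have h : ∑ j, (p.1 j - (ξ j).toNat) + ∑ j, (ξ j).toNat = ∑ j, p.1 j := by
      rw [← Finset.sum_add_distrib]
      refine Finset.sum_congr rfl fun j _ => ?_
      have := congrFun hp.2 j
      simp only [Pi.zero_apply] at this
      omega
    have : ∑ j, p.1 j = n + ∑ j, (ξ j).toNat := hp.1.1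
    omega
  · intro ν _
    simp
  · intro p hp
    have hp := (Finset.mem_filter.mp hp).2
    refine Prod.ext (funext fun j => ?_) (funext fun j => ?_) <;>
    · have := congrFun hp j
      simp only [Pi.zero_apply] at this ⊢
      omega
  · intro ν _
    rfl

theorem wcount_integral_representation
    (d n : ℕ) (hd : 1 ≤ d) (ξ : Fin d → ℤ) :
    (wcount d n ξ : ℂ) =
      (1 / (2 * Real.pi) ^ d : ℝ) •
        ∫ θ in Set.univ.pi fun _ : Fin d => Set.Icc (0:ℝ) (2 * Real.pi),
          Complex.exp (-Complex.I * ∑ j, (ξ j : ℂ) * (θ j : ℂ)) *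
            (∑ j, Complex.exp (Complex.I * (θ j : ℂ))) ^ (n + ∑ j, (ξ j).toNat) *
            (∑ j, Complex.exp (-Complex.I * (θ j : ℂ))) ^ (n + ∑ j, (-ξ j).toNat) := by
  simp_rw [exp_mul_sum_pow_mul_sum_pow]
  rw [integral_finsetSum]
  · simp_rw [integral_const_mul]
    have hπ : ((2 * Real.pi) ^ d : ℝ) ≠ 0 := by positivity
    rw [wcount_eq_sum_filter, Finset.sum_filter, Finset.smul_sum, Nat.cast_sum]
    refine Finset.sum_congr rfl fun p _ => ?_
    rw [integral_box_exp_int (fun j => (p.1 j : ℤ) - (p.2 j : ℤ) - ξ j), Fintype.card_fin]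
    split_ifs
    · rw [Complex.real_smul, mul_left_comm, ← Complex.ofReal_mul, one_div,
        inv_mul_cancel₀ hπ, Complex.ofReal_one, mul_one]
    · simp
  · intro p _
    refine ContinuousOn.integrableOn_compact
      (isCompact_univ_pi fun _ => isCompact_Icc) (Continuous.continuousOn ?_)
    fun_prop
end

section
/- Let d ≥ 2, n ∈ ℕ, ξ ∈ ℤ^d, and let S ⊆ {1,…,d} be a subset with 1 ≤ |S| = t ≤ d − 1, with elements s₁ < ⋯ < s_t and complement S^c with elements listed in increasing order. Then w_{(n,ξ)} = Σ_{j=0}^{n} C(n+|ξ⁺|, j + ξ_{s₁}⁺ + ⋯ + ξ_{s_t}⁺) · C(n+|ξ⁻|, j + ξ_{s₁}⁻ + ⋯ + ξ_{s_t}⁻) · w_{(j, (ξ_{s₁},…,ξ_{s_t}))} · w_{(n−j, ξ|_{S^c})}, where ξ|_{S^c} ∈ ℤ^{d−t} is the vector of components of ξ with indices outside S, C(a,b) denotes the binomial coefficient, and the inner w-quantities are the offset-word counts in t and d − t letters respectively. -/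
open scoped Nat in
/-- Splitting an alphabet into two parts factors a multinomial coefficient through the binomial
coefficient that counts the positions of the letters of the first part. -/
theorem multinomial_univ_of_sumEquiv {α β γ : Type*} [Fintype α] [Fintype β] [Fintype γ]
    (e : α ⊕ β ≃ γ) (f : γ → ℕ) :
    Nat.multinomial Finset.univ f =
      (∑ i, f i).choose (∑ i, f (e (Sum.inl i))) *
        Nat.multinomial Finset.univ (fun i => f (e (Sum.inl i))) *
        Nat.multinomial Finset.univ (fun i => f (e (Sum.inr i))) := by
  have hsum : ∑ i, f i = ∑ i, f (e (Sum.inl i)) + ∑ i, f (e (Sum.inr i)) := by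
    rw [← e.sum_comp, Fintype.sum_sum_type]
  have hprod : ∏ i, (f i)! = (∏ i, (f (e (Sum.inl i)))!) * ∏ i, (f (e (Sum.inr i)))! := by
    rw [← e.prod_comp, Fintype.prod_sum_type]
  have hpos : 0 < ∏ i, (f i)! := Finset.prod_pos fun _ _ => Nat.factorial_pos _
  refine Nat.eq_of_mul_eq_mul_left hpos ?_
  rw [Nat.multinomial_spec, hprod, hsum, ← Nat.add_choose_mul_factorial_mul_factorial, ← Nat.choose_symm_add,
    ← Nat.multinomial_spec Finset.univ fun i => f (e (Sum.inl i)),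
    ← Nat.multinomial_spec Finset.univ fun i => f (e (Sum.inr i))]
  ring

/-- The recurrence for offset words, for an arbitrary splitting of the alphabet into two parts. -/
theorem wcount_of_sumEquiv {t u d : ℕ} (e : Fin t ⊕ Fin u ≃ Fin d) (n : ℕ) (ξ : Fin d → ℤ) :
    wcount d n ξ =
      ∑ p ∈ Finset.HasAntidiagonal.antidiagonal n,
        (n + ∑ i, (ξ i).toNat).choose (p.1 + ∑ i, (ξ (e (Sum.inl i))).toNat) *
          (n + ∑ i, (-ξ i).toNat).choose (p.1 + ∑ i, (-ξ (e (Sum.inl i))).toNat) *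
          wcount t p.1 (fun i => ξ (e (Sum.inl i))) *
          wcount u p.2 (fun i => ξ (e (Sum.inr i))) := by
  simp only [wcount, mul_assoc]
  simp only [Finset.sum_mul_sum, ← Finset.sum_product']
  simp only [Finset.mul_sum]
  rw [Finset.sum_sigma']
  refine Finset.sum_bij'
    (fun ν _ => ⟨(∑ i, ν (e (Sum.inl i)), ∑ i, ν (e (Sum.inr i))),
      (fun i => ν (e (Sum.inl i)), fun i => ν (e (Sum.inr i)))⟩)
    (fun x _ => Sum.elim x.2.1 x.2.2 ∘ e.symm) ?_ ?_ ?_ ?_ ?_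
  · intro ν hν
    rw [Finset.Nat.mem_antidiagonalTuple, ← e.sum_comp, Fintype.sum_sum_type] at hν
    simp [Finset.Nat.mem_antidiagonalTuple, hν]
  · rintro ⟨⟨a, b⟩, μ, ρ⟩ h
    simp only [Finset.mem_sigma, Finset.HasAntidiagonal.mem_antidiagonal, Finset.mem_product,
      Finset.Nat.mem_antidiagonalTuple] at h
    rw [Finset.Nat.mem_antidiagonalTuple, ← e.sum_comp, Fintype.sum_sum_type]
    simp [h]
  · intro ν _
    funext i
    obtain ⟨j | j, rfl⟩ := e.surjective i <;> simp
  · rintro ⟨⟨a, b⟩, μ, ρ⟩ h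
    simp only [Finset.mem_sigma, Finset.HasAntidiagonal.mem_antidiagonal, Finset.mem_product,
      Finset.Nat.mem_antidiagonalTuple] at h
    obtain ⟨-, rfl, rfl⟩ := h
    simp
  · intro ν hν
    rw [Finset.Nat.mem_antidiagonalTuple] at hν
    rw [multinomial_univ_of_sumEquiv e, multinomial_univ_of_sumEquiv e]
    simp only [Finset.sum_add_distrib, hν]
    ring

theorem wcount_recurrence
    (d : ℕ) (hd : 2 ≤ d) (n : ℕ) (ξ : Fin d → ℤ)
    (S : Finset (Fin d)) (t : ℕ) (htS : S.card = t) (ht1 : 1 ≤ t) (ht2 : t ≤ d - 1)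
    (htSc : Sᶜ.card = d - t) :
    wcount d n ξ =
      ∑ j ∈ Finset.range (n + 1),
        Nat.choose (n + ∑ i, (ξ i).toNat) (j + ∑ i ∈ S, (ξ i).toNat) *
          Nat.choose (n + ∑ i, (-ξ i).toNat) (j + ∑ i ∈ S, (-ξ i).toNat) *
          wcount t j (fun i => ξ ((S.orderIsoOfFin htS i : S) : Fin d)) *
          wcount (d - t) (n - j) (fun i => ξ ((Sᶜ.orderIsoOfFin htSc i : (Sᶜ : Finset (Fin d))) : Fin d)) := by
  rw [wcount_of_sumEquiv (finSumEquivOfFinset htS htSc),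
    Finset.Nat.sum_antidiagonal_eq_sum_range_succ_mk]
  have hsum (f : Fin d → ℕ) : ∑ i ∈ S, f i = ∑ i, f (S.orderEmbOfFin htS i) := by
    rw [← Finset.sum_coe_sort, ← (S.orderIsoOfFin htS).toEquiv.sum_comp]
    rfl
  simp only [hsum, finSumEquivOfFinset_inl, finSumEquivOfFinset_inr,
    Finset.coe_orderIsoOfFin_apply]
end

section
/- Let d ≥ 1, n ∈ ℕ, and m ∈ ℤ, with n and m not both zero. Then d divides w_{(n, m·𝟏_d)}, where m·𝟏_d ∈ ℤ^d is the vector all of whose components equal m. -/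
/-- The absorption identity for multinomial coefficients, as a divisibility. -/
theorem Nat.sum_dvd_mul_multinomial {α : Type*} [DecidableEq α] {s : Finset α} {i : α}
    (hi : i ∈ s) (f : α → ℕ) : (∑ j ∈ s, f j) ∣ f i * Nat.multinomial s f := by
  rw [← Finset.insert_erase hi, Nat.multinomial_insert (Finset.notMem_erase i s),
    Finset.sum_insert (Finset.notMem_erase i s), ← mul_assoc]
  refine Dvd.dvd.mul_right ?_ _
  cases hfi : f i with
  | zero => simp
  | succ k =>
    rw [Nat.add_right_comm, mul_comm, ← Nat.add_one_mul_choose_eq]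
    exact Nat.dvd_mul_right _ _

theorem Nat.multinomial_univ_comp_perm {α : Type*} [Fintype α] (σ : Equiv.Perm α) (f : α → ℕ) :
    Nat.multinomial Finset.univ (fun j => f (σ j)) = Nat.multinomial Finset.univ f := by
  unfold Nat.multinomial
  rw [Equiv.sum_comp σ f, Equiv.prod_comp σ (fun j => (f j).factorial)]

theorem Finset.Nat.sum_antidiagonalTuple_comp_perm {M : Type*} [AddCommMonoid M] {d : ℕ} (n : ℕ)
    (σ : Equiv.Perm (Fin d)) (F : (Fin d → ℕ) → M) :
    ∑ ν ∈ Finset.Nat.antidiagonalTuple d n, F (fun j => ν (σ j)) =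
      ∑ ν ∈ Finset.Nat.antidiagonalTuple d n, F ν := by
  refine Finset.sum_equiv (σ.symm.arrowCongr (Equiv.refl ℕ)) (fun ν => ?_) (fun ν _ => rfl)
  simp only [Finset.Nat.mem_antidiagonalTuple]
  exact Eq.congr_left (Equiv.sum_comp σ ν).symm

theorem dvd_sum_multinomial_mul_multinomial {d n : ℕ} (a b : ℕ) (hN : 0 < n + d * a) :
    d ∣ ∑ ν ∈ Finset.Nat.antidiagonalTuple d n,
      Nat.multinomial Finset.univ (fun j => ν j + a) *
        Nat.multinomial Finset.univ (fun j => ν j + b) := by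
  rcases Nat.eq_zero_or_pos d with rfl | hd
  · have hn : n ≠ 0 := by omega
    obtain ⟨k, rfl⟩ := Nat.exists_eq_succ_of_ne_zero hn
    simp
  let G : (Fin d → ℕ) → ℕ := fun ν =>
    Nat.multinomial Finset.univ (fun j => ν j + a) *
      Nat.multinomial Finset.univ (fun j => ν j + b)
  change d ∣ ∑ ν ∈ Finset.Nat.antidiagonalTuple d n, G ν
  have hsum : ∀ ν ∈ Finset.Nat.antidiagonalTuple d n, ∑ j, (ν j + a) = n + d * a := by
    intro ν hν
    rw [Finset.sum_add_distrib, Finset.Nat.mem_antidiagonalTuple.1 hν]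
    simp
  let i₀ : Fin d := ⟨0, hd⟩
  have hsymm : ∀ i : Fin d, ∑ ν ∈ Finset.Nat.antidiagonalTuple d n, (ν i + a) * G ν =
      ∑ ν ∈ Finset.Nat.antidiagonalTuple d n, (ν i₀ + a) * G ν := by
    intro i
    rw [← Finset.Nat.sum_antidiagonalTuple_comp_perm n (Equiv.swap i i₀)]
    refine Finset.sum_congr rfl fun ν _ => ?_
    simp only [G, Equiv.swap_apply_left]
    rw [Nat.multinomial_univ_comp_perm (Equiv.swap i i₀) (fun j => ν j + a),
      Nat.multinomial_univ_comp_perm (Equiv.swap i i₀) (fun j => ν j + b)]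
  have htotal : (n + d * a) * ∑ ν ∈ Finset.Nat.antidiagonalTuple d n, G ν =
      d * ∑ ν ∈ Finset.Nat.antidiagonalTuple d n, (ν i₀ + a) * G ν := by
    calc _ = ∑ ν ∈ Finset.Nat.antidiagonalTuple d n, ∑ i, (ν i + a) * G ν := by
          rw [Finset.mul_sum]
          refine Finset.sum_congr rfl fun ν hν => ?_
          rw [← Finset.sum_mul, hsum ν hν]
      _ = _ := by
          rw [Finset.sum_comm, Finset.sum_congr rfl fun i _ => hsymm i]
          simp
  have hdvd : (n + d * a) ∣ ∑ ν ∈ Finset.Nat.antidiagonalTuple d n, (ν i₀ + a) * G ν := by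
    refine Finset.dvd_sum fun ν hν => ?_
    rw [← hsum ν hν, ← mul_assoc]
    exact (Nat.sum_dvd_mul_multinomial (Finset.mem_univ i₀) fun j => ν j + a).mul_right _
  obtain ⟨K, hK⟩ := hdvd
  refine ⟨K, Nat.eq_of_mul_eq_mul_left hN ?_⟩
  rw [htotal, hK]
  ring

theorem dvd_wcount_constant_offset
    (d n : ℕ) (hd : 1 ≤ d) (m : ℤ) (h : ¬ (n = 0 ∧ m = 0)) :
    d ∣ wcount d n (fun _ => m) := by
  unfold wcount
  by_cases hm : 0 < n + d * m.toNat
  · exact dvd_sum_multinomial_mul_multinomial _ _ hm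
  · have hneg : 0 < n + d * (-m).toNat := by
      rcases Nat.eq_zero_or_pos n with rfl | hn
      · have hprod : d * m.toNat = 0 := by omega
        have hm0 : m.toNat = 0 := (Nat.mul_eq_zero.1 hprod).resolve_left (by omega)
        have : 0 < d * (-m).toNat := Nat.mul_pos hd (by omega)
        omega
      · omega
    simp only [mul_comm (Nat.multinomial _ fun j => _ + m.toNat)]
    exact dvd_sum_multinomial_mul_multinomial _ _ hneg
end

section
/- Let d ≥ 2, n ∈ ℕ, and ξ ∈ ℤ^d with ξ ≠ 0. For each integer a, let o_a(ξ) be the number of indices j with ξ_j = a. Then lcm(1, 2, …, M) divides w_{(n,ξ)}, where M = max_{a ≠ 0} o_a(ξ) (note M ≥ 1 since ξ ≠ 0). -/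
open Finset in
/-- The multinomial coefficient of a subset of the letters divides the full one. -/
theorem multinomial_dvd_of_subset {ι : Type*} [DecidableEq ι] {S T : Finset ι} (h : S ⊆ T)
    (μ : ι → ℕ) : Nat.multinomial S μ ∣ Nat.multinomial T μ := by
  have hsum := sum_sdiff h (f := μ)
  have hprod := prod_sdiff h (f := fun i => (μ i).factorial)
  have hT := Nat.multinomial_spec T μ
  have hS := Nat.multinomial_spec S μ
  have hR := Nat.multinomial_spec (T \ S) μ
  obtain ⟨c, hc⟩ := Nat.factorial_mul_factorial_dvd_factorial_add (∑ i ∈ T \ S, μ i) (∑ i ∈ S, μ i)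
  refine ⟨Nat.multinomial (T \ S) μ * c, ?_⟩
  have hpos : 0 < ∏ i ∈ T, (μ i).factorial := prod_pos fun i _ => (μ i).factorial_pos
  refine Nat.eq_of_mul_eq_mul_left hpos ?_
  rw [hT, ← hsum, hc, ← hS, ← hR, ← hprod]
  ring

open Finset in
/-- The quotient counts the words of content `μ` whose first letter from `S` is `s`. -/
theorem sum_dvd_multinomial_mul {ι : Type*} [DecidableEq ι] {S T : Finset ι} (h : S ⊆ T)
    (μ : ι → ℕ) {s : ι} (hs : s ∈ S) :
    ∑ i ∈ S, μ i ∣ Nat.multinomial T μ * μ s := by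
  suffices H : ∑ i ∈ S, μ i ∣ Nat.multinomial S μ * μ s from
    H.trans (mul_dvd_mul_right (multinomial_dvd_of_subset h μ) _)
  rcases Nat.eq_zero_or_pos (μ s) with h0 | hpos
  · simp [h0]
  obtain ⟨k, hk⟩ : ∃ k, μ s = k + 1 := ⟨μ s - 1, by omega⟩
  have hS := Nat.multinomial_spec S μ
  have hS' := Nat.multinomial_spec S (Function.update μ s k)
  rw [sum_update_of_mem hs, ← mul_prod_erase _ _ hs] at hS'
  rw [← mul_prod_erase _ _ hs] at hS
  have hprod : ∏ i ∈ S.erase s, (Function.update μ s k i).factorial =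
      ∏ i ∈ S.erase s, (μ i).factorial :=
    prod_congr rfl fun i hi => by rw [Function.update_of_ne (ne_of_mem_erase hi)]
  have hsum : ∑ i ∈ S, μ i = (k + ∑ i ∈ S \ {s}, μ i) + 1 := by
    rw [← add_sum_erase _ _ hs, hk, sdiff_singleton_eq_erase]; ring
  rw [hprod, Function.update_self] at hS'
  rw [hsum, Nat.factorial_succ, ← hS', hk, Nat.factorial_succ] at hS
  refine ⟨Nat.multinomial S (Function.update μ s k), ?_⟩
  have hP : 0 < k.factorial * ∏ i ∈ S.erase s, (μ i).factorial :=
    mul_pos k.factorial_pos (prod_pos fun i _ => (μ i).factorial_pos)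
  refine Nat.eq_of_mul_eq_mul_left hP ?_
  rw [hsum, hk]
  linear_combination hS

open Finset in
theorem multinomial_univ_comp_equiv {ι : Type*} [Fintype ι] (μ : ι → ℕ) (e : Equiv.Perm ι) :
    Nat.multinomial univ (fun i => μ (e i)) = Nat.multinomial univ μ := by
  unfold Nat.multinomial
  rw [Equiv.sum_comp e μ, Equiv.prod_comp e fun i => (μ i).factorial]

theorem wcount_neg (d n : ℕ) (ξ : Fin d → ℤ) : wcount d n (-ξ) = wcount d n ξ := by
  simp [wcount, mul_comm]

open Finset in
theorem card_dvd_wcount_of_pos {d : ℕ} (n : ℕ) (ξ : Fin d → ℤ) {a : ℤ} (ha : 0 < a)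
    {S : Finset (Fin d)} (hne : S.Nonempty) (hS : ∀ j ∈ S, ξ j = a) : S.card ∣ wcount d n ξ := by
  obtain ⟨s, hs⟩ := hne
  -- the number of word pairs of type `ν` whose first letter from `S` is `t`
  let F (ν : Fin d → ℕ) (t : Fin d) : ℕ :=
    Nat.multinomial univ (fun j => ν j + (ξ j).toNat) * (ν t + (ξ t).toNat) /
      (∑ j ∈ S, (ν j + (ξ j).toNat)) * Nat.multinomial univ (fun j => ν j + (-ξ j).toNat)
  have hF (ν : Fin d → ℕ) : ∑ t ∈ S, F ν t =
      Nat.multinomial univ (fun j => ν j + (ξ j).toNat) *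
        Nat.multinomial univ (fun j => ν j + (-ξ j).toNat) := by
    have hpos : 0 < ∑ j ∈ S, (ν j + (ξ j).toNat) :=
      sum_pos (fun j hj => by have := hS j hj; omega) ⟨s, hs⟩
    rw [← sum_mul, ← Nat.sum_div fun t ht => sum_dvd_multinomial_mul (subset_univ S) _ ht,
      ← mul_sum, Nat.mul_div_cancel _ hpos]
  have hswap (t : Fin d) (ht : t ∈ S) :
      ∑ ν ∈ Finset.Nat.antidiagonalTuple d n, F ν t =
        ∑ ν ∈ Finset.Nat.antidiagonalTuple d n, F ν s := by
    have hξ (j : Fin d) : ξ (Equiv.swap s t j) = ξ j := by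
      rw [Equiv.swap_apply_def]
      split_ifs with h₁ h₂
      · rw [h₁, hS t ht, hS s hs]
      · rw [h₂, hS t ht, hS s hs]
      · rfl
    have hmem (j : Fin d) : j ∈ S ↔ Equiv.swap s t j ∈ S := by
      rw [Equiv.swap_apply_def]
      split_ifs with h₁ h₂ <;> simp [*]
    refine sum_equiv (Equiv.arrowCongr (Equiv.swap s t) (Equiv.refl ℕ)) (fun ν => ?_)
      fun ν _ => ?_
    · simp only [Finset.Nat.mem_antidiagonalTuple, Equiv.arrowCongr_apply, Equiv.coe_refl,
        Function.comp_apply, id_eq, Equiv.symm_swap, Equiv.sum_comp (Equiv.swap s t) ν]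
    · have h₁ := multinomial_univ_comp_equiv (fun j => ν j + (ξ j).toNat) (Equiv.swap s t)
      have h₂ := multinomial_univ_comp_equiv (fun j => ν j + (-ξ j).toNat) (Equiv.swap s t)
      have h₃ : ∑ j ∈ S, (ν (Equiv.swap s t j) + (ξ (Equiv.swap s t j)).toNat) =
          ∑ j ∈ S, (ν j + (ξ j).toNat) :=
        sum_equiv (Equiv.swap s t) hmem fun _ _ => rfl
      simp only [hξ] at h₁ h₂ h₃
      simp only [F, Equiv.arrowCongr_apply, Equiv.coe_refl, Function.comp_apply, id_eq,
        Equiv.symm_swap, Equiv.swap_apply_left, h₁, h₂, h₃, hS t ht, hS s hs]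
  refine ⟨∑ ν ∈ Finset.Nat.antidiagonalTuple d n, F ν s, ?_⟩
  rw [wcount, ← sum_congr rfl fun ν _ => hF ν, sum_comm, sum_congr rfl hswap, sum_const,
    smul_eq_mul]

theorem lcm_dvd_wcount
    (d : ℕ) (hd : 2 ≤ d) (n : ℕ) (ξ : Fin d → ℤ) (hξ : ξ ≠ 0)
    (M : ℕ)
    (hM : M = ((Finset.univ.image ξ).erase 0).sup
        fun a => (Finset.univ.filter fun j => ξ j = a).card) :
    (Finset.Icc 1 M).lcm id ∣ wcount d n ξ := by
  refine Finset.lcm_dvd fun m hm => ?_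
  obtain ⟨hm₁, hm₂⟩ := Finset.mem_Icc.mp hm
  rw [hM, Finset.le_sup_iff (Nat.lt_of_lt_of_le Nat.zero_lt_one hm₁)] at hm₂
  obtain ⟨a, ha, hma⟩ := hm₂
  obtain ⟨S, hSsub, rfl⟩ := Finset.exists_subset_card_eq hma
  have hS (j : Fin d) (hj : j ∈ S) : ξ j = a := (Finset.mem_filter.mp (hSsub hj)).2
  have hne : S.Nonempty := Finset.card_pos.mp hm₁
  rcases lt_or_gt_of_ne (Finset.ne_of_mem_erase ha) with h | h
  · rw [← wcount_neg]
    exact card_dvd_wcount_of_pos n (-ξ) (neg_pos.mpr h) hne fun j hj => by simp [hS j hj]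
  · exact card_dvd_wcount_of_pos n ξ h hne hS
end

section
/- Let n ∈ ℕ be fixed. Then, as d → ∞, w_{(n, 𝟎_d)} = n! · d^n + O(d^{n−1}); that is, there exist constants C > 0 and D ∈ ℕ such that for all integers d ≥ D, | w_{(n, 𝟎_d)} − n! d^n | ≤ C d^{n−1}. (Here w_{(n, 𝟎_d)} is the number of abelian squares of length 2n over a d-letter alphabet.) -/
/-- The number of abelian squares of length `2n` over a `d`-letter alphabet. -/
def abSq (d n : ℕ) : ℕ :=
  ∑ ν ∈ Finset.Nat.antidiagonalTuple d n,
    (Nat.multinomial Finset.univ ν) ^ 2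

theorem abSq_le_factorial_mul_pow (d n : ℕ) : abSq d n ≤ n.factorial * d ^ n := by
  have hmul : d ^ n = ∑ ν ∈ Finset.Nat.antidiagonalTuple d n, Nat.multinomial Finset.univ ν := by
    have h := Finset.sum_pow_eq_sum_piAntidiag (Finset.univ : Finset (Fin d)) (fun _ => (1 : ℕ)) n
    simp only [Finset.sum_const, Finset.card_univ, Fintype.card_fin, smul_eq_mul, mul_one, one_pow,
      Finset.prod_const_one, Nat.cast_id] at h
    rw [h]
    refine Finset.sum_congr ?_ fun _ _ => rfl
    ext ν
    simp [Finset.Nat.mem_antidiagonalTuple]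
  rw [hmul, Finset.mul_sum, abSq]
  refine Finset.sum_le_sum fun ν hν => ?_
  rw [sq]
  refine Nat.mul_le_mul_right _ ?_
  rw [Finset.Nat.mem_antidiagonalTuple] at hν
  rw [Nat.multinomial, hν]
  exact Nat.div_le_self _ _

theorem factorial_mul_descFactorial_le_abSq (d n : ℕ) :
    n.factorial * d.descFactorial n ≤ abSq d n := by
  let χ : Finset (Fin d) → Fin d → ℕ := fun s i => if i ∈ s then 1 else 0
  have hinj : Function.Injective χ := by
    intro s t h
    ext i
    have hi := congrFun h i
    simp only [χ] at hi
    split_ifs at hi <;> simp_all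
  have hsum (s : Finset (Fin d)) : ∑ i, χ s i = s.card := by simp [χ]
  have hmult (s : Finset (Fin d)) : Nat.multinomial Finset.univ (χ s) = s.card.factorial := by
    have hprod : ∏ i, (χ s i).factorial = 1 := by
      refine Finset.prod_eq_one fun i _ => ?_
      simp only [χ]
      split_ifs <;> rfl
    rw [Nat.multinomial, hsum, hprod, Nat.div_one]
  calc n.factorial * d.descFactorial n
      = ∑ s ∈ Finset.powersetCard n (Finset.univ : Finset (Fin d)),
          (Nat.multinomial Finset.univ (χ s)) ^ 2 := by
        rw [Finset.sum_congr rfl (g := fun _ => n.factorial ^ 2) fun s hs => by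
          rw [hmult, (Finset.mem_powersetCard.mp hs).2]]
        rw [Finset.sum_const, Finset.card_powersetCard, Finset.card_univ, Fintype.card_fin,
          Nat.descFactorial_eq_factorial_mul_choose, smul_eq_mul]
        ring
    _ = ∑ ν ∈ (Finset.powersetCard n Finset.univ).image χ,
          (Nat.multinomial Finset.univ ν) ^ 2 := by
        rw [Finset.sum_image fun _ _ _ _ h => hinj h]
    _ ≤ abSq d n := by
        refine Finset.sum_le_sum_of_subset fun ν hν => ?_
        obtain ⟨s, hs, rfl⟩ := Finset.mem_image.mp hν
        rw [Finset.Nat.mem_antidiagonalTuple, hsum, (Finset.mem_powersetCard.mp hs).2]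

theorem pow_sub_mul_pow_le_descFactorial {d n : ℕ} (hd : 0 < d) (hn : n ≤ d) :
    (d : ℝ) ^ n - (n : ℝ) ^ 2 * (d : ℝ) ^ ((n : ℝ) - 1) ≤ (d.descFactorial n : ℝ) := by
  have hd' : (0 : ℝ) < d := by exact_mod_cast hd
  have hnd : (n : ℝ) / d ≤ 1 := (div_le_one hd').mpr (by exact_mod_cast hn)
  have hbern := one_add_mul_le_pow (a := -((n : ℝ) / d)) (by linarith) n
  have hdesc : ((d : ℝ) - n) ^ n ≤ (d.descFactorial n : ℝ) := by
    rw [← Nat.cast_sub hn]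
    exact_mod_cast (Nat.pow_le_pow_left (by omega) n).trans (Nat.pow_sub_le_descFactorial d n)
  calc (d : ℝ) ^ n - (n : ℝ) ^ 2 * (d : ℝ) ^ ((n : ℝ) - 1)
      = (d : ℝ) ^ n * (1 + n * -((n : ℝ) / d)) := by
        rw [Real.rpow_sub_one hd'.ne', Real.rpow_natCast]
        ring
    _ ≤ (d : ℝ) ^ n * (1 + -((n : ℝ) / d)) ^ n := by gcongr
    _ = ((d : ℝ) - n) ^ n := by
        rw [← mul_pow]
        congr 1
        field_simp
        ring
    _ ≤ _ := hdesc

theorem abelian_squares_large_alphabet_asymptotic (n : ℕ) :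
    ∃ C > (0 : ℝ), ∃ D : ℕ, ∀ d : ℕ, d ≥ D →
      |(abSq d n : ℝ) - (n.factorial : ℝ) * (d : ℝ) ^ n|
        ≤ C * (d : ℝ) ^ ((n : ℝ) - 1) := by
  refine ⟨n.factorial * ((n : ℝ) ^ 2 + 1), by positivity, n + 1, fun d hd => ?_⟩
  have hupper : (abSq d n : ℝ) ≤ n.factorial * (d : ℝ) ^ n := by
    exact_mod_cast abSq_le_factorial_mul_pow d n
  have hlower : (n.factorial : ℝ) * d.descFactorial n ≤ abSq d n := by
    exact_mod_cast factorial_mul_descFactorial_le_abSq d n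
  have hdesc := mul_le_mul_of_nonneg_left
    (pow_sub_mul_pow_le_descFactorial (d := d) (n := n) (by omega) (by omega))
    (Nat.cast_nonneg (α := ℝ) n.factorial)
  have hpos : 0 ≤ (n.factorial : ℝ) * (d : ℝ) ^ ((n : ℝ) - 1) := by positivity
  rw [abs_of_nonpos (by linarith)]
  linarith
end

section
/- Let d ≥ 1 and ξ ∈ ℤ^d. Then limsup_{n→∞} (w_{(n,ξ)})^{1/n} = d²; consequently the ordinary generating function W_ξ(x) = Σ_{n=0}^∞ w_{(n,ξ)} x^n has radius of convergence 1/d². -/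
open Filter Finset Topology

theorem Nat.add_choose_le_add_choose {a b p q : ℕ} (ha : a ≤ p) (hb : b ≤ q) :
    (a + b).choose a ≤ (p + q).choose p :=
  calc (a + b).choose a ≤ (a + q).choose a := Nat.choose_le_choose _ (by omega)
    _ = (a + q).choose q := Nat.choose_symm_add
    _ ≤ (p + q).choose q := Nat.choose_le_choose _ (by omega)
    _ = (p + q).choose p := Nat.choose_symm_add.symm

theorem Nat.multinomial_le_multinomial {ι : Type*} (s : Finset ι) {f g : ι → ℕ} (h : f ≤ g) :
    Nat.multinomial s f ≤ Nat.multinomial s g := by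
  classical
  induction s using Finset.induction_on with
  | empty => simp
  | insert a s ha ih =>
    rw [Nat.multinomial_insert ha, Nat.multinomial_insert ha]
    exact Nat.mul_le_mul
      (Nat.add_choose_le_add_choose (h a) (Finset.sum_le_sum fun i _ => h i)) ih

theorem sum_multinomial_antidiagonalTuple (d n : ℕ) :
    ∑ ν ∈ Finset.Nat.antidiagonalTuple d n, Nat.multinomial univ ν = d ^ n := by
  have h := Finset.sum_pow_eq_sum_piAntidiag (univ : Finset (Fin d)) (fun _ => (1 : ℕ)) n
  simp only [sum_const, card_univ, Fintype.card_fin, smul_eq_mul, mul_one, one_pow,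
    prod_const_one, Nat.cast_id] at h
  rw [h]
  refine Finset.sum_congr ?_ fun _ _ => rfl
  ext ν
  simp [Finset.Nat.mem_antidiagonalTuple]

theorem sum_multinomial_add_le (d n : ℕ) (a : Fin d → ℕ) :
    ∑ ν ∈ Finset.Nat.antidiagonalTuple d n, Nat.multinomial univ (fun j => ν j + a j)
      ≤ d ^ (n + ∑ j, a j) := by
  rw [← sum_multinomial_antidiagonalTuple d (n + ∑ j, a j)]
  have hinj : Function.Injective fun (ν : Fin d → ℕ) j => ν j + a j := fun ν μ h => by
    funext j
    exact Nat.add_right_cancel (congrFun h j)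
  rw [← Finset.sum_image (f := fun μ : Fin d → ℕ => Nat.multinomial univ μ)
    (g := fun (ν : Fin d → ℕ) j => ν j + a j) (hinj.injOn)]
  refine Finset.sum_le_sum_of_subset fun μ hμ => ?_
  obtain ⟨ν, hν, rfl⟩ := Finset.mem_image.1 hμ
  rw [Finset.Nat.mem_antidiagonalTuple] at hν ⊢
  rw [Finset.sum_add_distrib, hν]

theorem multinomial_add_le (d n : ℕ) (a : Fin d → ℕ) {ν : Fin d → ℕ}
    (hν : ν ∈ Finset.Nat.antidiagonalTuple d n) :
    Nat.multinomial univ (fun j => ν j + a j) ≤ d ^ (n + ∑ j, a j) :=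
  (Finset.single_le_sum
    (f := fun ν : Fin d → ℕ => Nat.multinomial univ (fun j => ν j + a j))
    (fun _ _ => Nat.zero_le _) hν).trans (sum_multinomial_add_le d n a)

theorem card_antidiagonalTuple_le (d n : ℕ) :
    #(Finset.Nat.antidiagonalTuple d n) ≤ (n + 1) ^ d := by
  have hsub : Finset.Nat.antidiagonalTuple d n ⊆ Fintype.piFinset fun _ => range (n + 1) := by
    intro ν hν
    rw [Finset.Nat.mem_antidiagonalTuple] at hν
    refine Fintype.mem_piFinset.2 fun j => mem_range.2 (Nat.lt_succ_of_le ?_)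
    exact hν ▸ Finset.single_le_sum (fun _ _ => Nat.zero_le _) (mem_univ j)
  simpa using Finset.card_le_card hsub

theorem wcount_le (d n : ℕ) (ξ : Fin d → ℤ) :
    wcount d n ξ ≤ d ^ (∑ j, (ξ j).toNat + ∑ j, (-ξ j).toNat) * (d ^ 2) ^ n :=
  calc wcount d n ξ
      ≤ ∑ ν ∈ Finset.Nat.antidiagonalTuple d n,
          Nat.multinomial univ (fun j => ν j + (ξ j).toNat) * d ^ (n + ∑ j, (-ξ j).toNat) :=
        Finset.sum_le_sum fun _ hν => Nat.mul_le_mul_left _ (multinomial_add_le d n _ hν)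
    _ ≤ d ^ (n + ∑ j, (ξ j).toNat) * d ^ (n + ∑ j, (-ξ j).toNat) := by
        rw [← Finset.sum_mul]
        exact Nat.mul_le_mul_right _ (sum_multinomial_add_le d n _)
    _ = _ := by ring

theorem pow_le_mul_wcount (d n : ℕ) (ξ : Fin d → ℤ) :
    (d ^ 2) ^ n ≤ (n + 1) ^ d * wcount d n ξ :=
  calc (d ^ 2) ^ n = (∑ ν ∈ Finset.Nat.antidiagonalTuple d n, Nat.multinomial univ ν) ^ 2 := by
        rw [sum_multinomial_antidiagonalTuple, ← pow_mul, ← pow_mul, mul_comm]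
    _ ≤ #(Finset.Nat.antidiagonalTuple d n) *
          ∑ ν ∈ Finset.Nat.antidiagonalTuple d n, Nat.multinomial univ ν ^ 2 := by
        exact_mod_cast sq_sum_le_card_mul_sum_sq (α := ℤ)
          (s := Finset.Nat.antidiagonalTuple d n) (f := fun ν => (Nat.multinomial univ ν : ℤ))
    _ ≤ (n + 1) ^ d * wcount d n ξ := by
        refine Nat.mul_le_mul (card_antidiagonalTuple_le d n) (Finset.sum_le_sum fun ν _ => ?_)
        rw [sq]
        exact Nat.mul_le_mul
          (Nat.multinomial_le_multinomial _ fun _ => Nat.le_add_right _ _)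
          (Nat.multinomial_le_multinomial _ fun _ => Nat.le_add_right _ _)

theorem pow_le_const_mul_pow_mul_wcount (d : ℕ) {n : ℕ} (hn : 1 ≤ n) (ξ : Fin d → ℤ) :
    ((d : ℝ) ^ 2) ^ n ≤ 2 ^ d * (n : ℝ) ^ d * wcount d n ξ := by
  have h : (d ^ 2) ^ n ≤ 2 ^ d * n ^ d * wcount d n ξ := by
    refine (pow_le_mul_wcount d n ξ).trans (Nat.mul_le_mul_right _ ?_)
    rw [← mul_pow]
    exact Nat.pow_le_pow_left (by omega) d
  exact_mod_cast h

theorem tendsto_const_rpow_one_div_natCast {c : ℝ} (hc : 0 < c) :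
    Tendsto (fun n : ℕ => c ^ (1 / (n : ℝ))) atTop (𝓝 1) := by
  simpa using (tendsto_const_nhds (x := c)).rpow
    (tendsto_one_div_atTop_nhds_zero_nat (𝕜 := ℝ)) (Or.inl hc.ne')

theorem pow_rpow_one_div_natCast {a : ℝ} (ha : 0 ≤ a) {n : ℕ} (hn : 1 ≤ n) :
    (a ^ n) ^ (1 / (n : ℝ)) = a := by
  rw [one_div, Real.pow_rpow_inv_natCast ha (by omega)]

/-- A sequence squeezed between `A ^ n / (c * n ^ k)` and `C * A ^ n` has `n`-th roots
tending to `A`. -/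
theorem tendsto_rpow_one_div_of_le_of_le {u : ℕ → ℝ} {A c C : ℝ} {k : ℕ} (hA : 0 ≤ A)
    (hc : 0 < c) (hC : 0 < C) (hu : ∀ n, 0 ≤ u n) (hle : ∀ n, u n ≤ C * A ^ n)
    (hge : ∀ n : ℕ, 1 ≤ n → A ^ n ≤ c * (n : ℝ) ^ k * u n) :
    Tendsto (fun n : ℕ => u n ^ (1 / (n : ℝ))) atTop (𝓝 A) := by
  have hn1 : Tendsto (fun n : ℕ => (n : ℝ) ^ (1 / (n : ℝ))) atTop (𝓝 1) :=
    tendsto_rpow_div.comp tendsto_natCast_atTop_atTop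
  have hlow : Tendsto (fun n : ℕ => A / (c ^ (1 / (n : ℝ)) * ((n : ℝ) ^ (1 / (n : ℝ))) ^ k))
      atTop (𝓝 A) := by
    have h := (tendsto_const_nhds (x := A)).div
      ((tendsto_const_rpow_one_div_natCast hc).mul (hn1.pow k)) (by simp)
    rwa [one_pow, mul_one, div_one] at h
  have hupp : Tendsto (fun n : ℕ => C ^ (1 / (n : ℝ)) * A) atTop (𝓝 A) := by
    simpa using (tendsto_const_rpow_one_div_natCast hC).mul_const A
  refine tendsto_of_tendsto_of_tendsto_of_le_of_le' hlow hupp ?_ ?_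
  · filter_upwards [eventually_ge_atTop 1] with n hn
    have hn0 : (0 : ℝ) < n := by exact_mod_cast hn
    rw [div_le_iff₀ (by positivity)]
    have h := Real.rpow_le_rpow (by positivity) (hge n hn) (z := 1 / (n : ℝ)) (by positivity)
    rw [pow_rpow_one_div_natCast hA hn, Real.mul_rpow (by positivity) (hu n),
      Real.mul_rpow hc.le (by positivity), ← Real.rpow_natCast_mul hn0.le,
      mul_comm (k : ℝ), Real.rpow_mul_natCast hn0.le] at h
    linarith
  · filter_upwards [eventually_ge_atTop 1] with n hn
    have h := Real.rpow_le_rpow (hu n) (hle n) (z := 1 / (n : ℝ)) (by positivity)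
    rwa [Real.mul_rpow hC.le (by positivity), pow_rpow_one_div_natCast hA hn] at h

theorem wcount_root_limsup_and_radius
    (d : ℕ) (hd : 1 ≤ d) (ξ : Fin d → ℤ) :
    Filter.limsup (fun n : ℕ => (wcount d n ξ : ℝ) ^ (1 / (n : ℝ))) Filter.atTop
        = (d : ℝ) ^ 2 ∧
    (∀ x : ℝ, |x| < 1 / (d : ℝ) ^ 2 →
        Summable fun n : ℕ => (wcount d n ξ : ℝ) * x ^ n) ∧
    (∀ x : ℝ, 1 / (d : ℝ) ^ 2 < |x| →
        ¬ Summable fun n : ℕ => (wcount d n ξ : ℝ) * x ^ n) := by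
  have hd0 : (0 : ℝ) < d := by exact_mod_cast hd
  have hle (n : ℕ) : (wcount d n ξ : ℝ) ≤
      (d : ℝ) ^ (∑ j, (ξ j).toNat + ∑ j, (-ξ j).toNat) * ((d : ℝ) ^ 2) ^ n := by
    exact_mod_cast wcount_le d n ξ
  have hge (n : ℕ) (hn : 1 ≤ n) := pow_le_const_mul_pow_mul_wcount d hn ξ
  refine ⟨?_, fun x hx => ?_, fun x hx hsum => ?_⟩
  · exact (tendsto_rpow_one_div_of_le_of_le (by positivity) (by positivity) (by positivity)
      (fun n => Nat.cast_nonneg _) hle hge).limsup_eq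
  · rw [lt_div_iff₀ (by positivity)] at hx
    refine Summable.of_norm_bounded
      ((summable_geometric_of_lt_one (by positivity) hx).mul_left
        ((d : ℝ) ^ (∑ j, (ξ j).toNat + ∑ j, (-ξ j).toNat))) fun n => ?_
    rw [norm_mul, norm_pow, Real.norm_eq_abs, Real.norm_eq_abs, Nat.abs_cast]
    calc _ ≤ _ := mul_le_mul_of_nonneg_right (hle n) (by positivity)
      _ = _ := by ring
  · rw [div_lt_iff₀ (by positivity)] at hx
    have hx0 : 0 < |x| := by
      by_contra! h
      nlinarith [sq_nonneg (d : ℝ)]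
    have hlim := (hsum.tendsto_atTop_zero.abs.mul
      (tendsto_pow_const_div_const_pow_of_one_lt d hx)).const_mul ((2 : ℝ) ^ d)
    simp only [abs_zero, mul_zero] at hlim
    refine absurd (ge_of_tendsto hlim (b := 1) ?_) (by norm_num)
    filter_upwards [eventually_ge_atTop 1] with n hn
    rw [abs_mul, abs_pow, Nat.abs_cast, mul_pow]
    calc (1 : ℝ) ≤ 2 ^ d * (n : ℝ) ^ d * wcount d n ξ / ((d : ℝ) ^ 2) ^ n := by
          rw [le_div_iff₀ (by positivity), one_mul]
          exact hge n hn
      _ = _ := by field_simp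
end
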